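/- arXiv:1408.0161 — 4 statements merged into one kernel-verified Lean document; each statement's English description precedes it below -/
import Mathlib

section
/- Let N ≥ 1 be an integer and ε ∈ (0,1). There is a constant C_N depending only on N such that the following holds: if A is an N×N real symmetric positive definite matrix satisfying tr A ≤ N + ε and det A ≥ 1 − ε, then ‖A − I‖ ≤ C_N √ε, where I is the N×N identity matrix. -/
open Matrix in
/-- The squared Frobenius norm of `A - 1`, for `A` real symmetric, in terms of eigenvalues. -/
theorem Matrix.IsHermitian.sum_sq_sub_one {n : Type*} [Fintype n] [DecidableEq n]
    {A : Matrix n n ℝ} (hA : A.IsHermitian) :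
    ∑ i, ∑ j, ((A - 1) i j) ^ 2 = ∑ i, (hA.eigenvalues i - 1) ^ 2 := by
  have hB : (A - 1)ᵀ = A - 1 := by
    have h : Aᵀ = A := by simpa [conjTranspose_eq_transpose_of_trivial] using hA.eq
    rw [transpose_sub, h, transpose_one]
  have h₁ : ∑ i, ∑ j, ((A - 1) i j) ^ 2 = ((A - 1) * (A - 1)).trace := by
    nth_rewrite 3 [← hB]
    simp only [trace, diag_apply, mul_apply, transpose_apply, sq]
  have h₂ : A - 1 = Unitary.conjStarAlgAut ℝ _ hA.eigenvectorUnitary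
      (diagonal (fun i => hA.eigenvalues i - 1)) := by
    have hD : (diagonal (fun i => hA.eigenvalues i - 1) : Matrix n n ℝ)
        = diagonal (RCLike.ofReal ∘ hA.eigenvalues) - 1 := by
      rw [← diagonal_one, diagonal_sub]
      rfl
    rw [hD, map_sub, map_one, ← hA.spectral_theorem]
  rw [h₁, h₂, ← map_mul, Unitary.conjStarAlgAut_apply, trace_mul_cycle]
  simp [sq]

/-- On `(0, R + 1]`, the deficit of `x * exp (1 - x)` from its maximum `1` is at least
quadratic in `x - 1`. -/
theorem Real.sq_sub_one_le_of_le {x R : ℝ} (hx : 0 < x) (hxR : x ≤ R + 1) :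
    (x - 1) ^ 2 ≤ 4 * Real.exp R * (1 - x * Real.exp (1 - x)) := by
  have h₁ : x + (x - 1) ^ 2 / 4 ≤ Real.exp (x - 1) := by
    have h := Real.add_one_le_exp ((x - 1) / 2)
    have h' : Real.exp (x - 1) = Real.exp ((x - 1) / 2) ^ 2 := by
      rw [← Real.exp_nat_mul]
      congr 1
      push_cast
      ring
    rw [h']
    nlinarith
  have h₂ : Real.exp (x - 1) * Real.exp (1 - x) = 1 := by
    rw [← Real.exp_add]
    simp
  have h₃ : 1 ≤ Real.exp R * Real.exp (1 - x) := by
    rw [← Real.exp_add]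
    exact Real.one_le_exp (by linarith)
  have h₄ := mul_le_mul_of_nonneg_right h₁ (Real.exp_pos (1 - x)).le
  have h₅ : (x - 1) ^ 2 / 4 * Real.exp (1 - x) ≤ 1 - x * Real.exp (1 - x) := by linarith
  have h₆ := mul_le_mul_of_nonneg_left h₅ (Real.exp_pos R).le
  have h₇ := mul_le_mul_of_nonneg_left h₃ (sq_nonneg (x - 1))
  linarith

/-- If positive reals have sum at most `card + ε` and product at least `1 - ε`,
then each of them is within `O(√ε)` of `1`. -/
theorem Finset.sq_sub_one_le_of_sum_le_of_le_prod {ι : Type*} [Fintype ι] {x : ι → ℝ} {ε : ℝ}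
    (hx : ∀ i, 0 < x i) (hε : ε ≤ 1) (hsum : ∑ i, x i ≤ Fintype.card ι + ε)
    (hprod : 1 - ε ≤ ∏ i, x i) (i : ι) :
    (x i - 1) ^ 2 ≤ 8 * Real.exp (Fintype.card ι) * ε := by
  have hle : x i ≤ Fintype.card ι + 1 :=
    (Finset.single_le_sum (fun j _ => (hx j).le) (Finset.mem_univ i)).trans (by linarith)
  have hone : ∀ j, x j * Real.exp (1 - x j) ≤ 1 := fun j => by
    have h := mul_le_mul_of_nonneg_right (Real.add_one_le_exp (x j - 1))
      (Real.exp_pos (1 - x j)).le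
    rw [← Real.exp_add] at h
    simpa using h
  have hpos : ∀ j, 0 ≤ x j * Real.exp (1 - x j) := fun j =>
    mul_nonneg (hx j).le (Real.exp_pos _).le
  have hfac : ∏ j, x j * Real.exp (1 - x j) ≤ x i * Real.exp (1 - x i) := by
    classical
    rw [← Finset.mul_prod_erase _ _ (Finset.mem_univ i)]
    exact mul_le_of_le_one_right (hpos i)
      (Finset.prod_le_one (fun j _ => hpos j) (fun j _ => hone j))
  have hlow : 1 - 2 * ε ≤ ∏ j, x j * Real.exp (1 - x j) := by
    rw [Finset.prod_mul_distrib, ← Real.exp_sum]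
    have hexp : 1 - ε ≤ Real.exp (∑ j, (1 - x j)) := by
      have h := Real.add_one_le_exp (∑ j, (1 - x j))
      simp only [Finset.sum_sub_distrib, Finset.sum_const, Finset.card_univ, nsmul_eq_mul,
        mul_one] at h ⊢
      linarith
    have h := mul_le_mul hprod hexp (by linarith) (Finset.prod_nonneg fun j _ => (hx j).le)
    nlinarith [sq_nonneg ε]
  calc (x i - 1) ^ 2
      ≤ 4 * Real.exp (Fintype.card ι) * (1 - x i * Real.exp (1 - x i)) :=
        Real.sq_sub_one_le_of_le (hx i) hle
    _ ≤ 4 * Real.exp (Fintype.card ι) * (2 * ε) := by gcongr; linarith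
    _ = 8 * Real.exp (Fintype.card ι) * ε := by ring


/-- **Matrix lemma (real symmetric case).**
Let `N ≥ 1` be an integer and `ε ∈ (0,1)`. There is a constant `C` depending only on `N`
such that: if `A` is an `N × N` real symmetric positive definite matrix with
`tr A ≤ N + ε` and `det A ≥ 1 − ε`, then the Hilbert–Schmidt (Frobenius) norm of
`A − I` is at most `C * √ε`. -/
theorem matrix_trace_det_pinching_real (N : ℕ) (hN : 1 ≤ N) :
    ∃ C : ℝ, 0 < C ∧ ∀ (ε : ℝ), 0 < ε → ε < 1 →
      ∀ A : Matrix (Fin N) (Fin N) ℝ, A.IsSymm → A.PosDef →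
        A.trace ≤ (N : ℝ) + ε → (1 - ε) ≤ A.det →
        Real.sqrt (∑ i, ∑ j, ((A - 1) i j) ^ 2) ≤ C * Real.sqrt ε := by
  have hN' : (0 : ℝ) < N := by exact_mod_cast hN
  refine ⟨Real.sqrt (N * (8 * Real.exp N)), by positivity, ?_⟩
  intro ε _ hε1 A _ hA htr hdet
  have hH := hA.isHermitian
  rw [hH.trace_eq_sum_eigenvalues] at htr
  rw [hH.det_eq_prod_eigenvalues] at hdet
  rw [← Real.sqrt_mul (by positivity), hH.sum_sq_sub_one]
  apply Real.sqrt_le_sqrt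
  have hbound := Finset.sq_sub_one_le_of_sum_le_of_le_prod (x := hH.eigenvalues)
    hA.eigenvalues_pos hε1.le (by simpa using htr) (by simpa using hdet)
  calc ∑ i, (hH.eigenvalues i - 1) ^ 2
      ≤ ∑ _i : Fin N, 8 * Real.exp N * ε :=
        Finset.sum_le_sum fun i _ => by simpa using hbound i
    _ = N * (8 * Real.exp N) * ε := by simp; ring
end

section
/- Let N ≥ 1 be an integer and ε ∈ (0,1). There is a constant C_N depending only on N such that the following holds: if λ₁, …, λ_N are positive real numbers satisfying Σ_{j=1}^N λ_j ≤ N + ε and ∏_{j=1}^N λ_j ≥ 1 − ε, then Σ_{j=1}^N (λ_j − 1)² ≤ C_N ε. -/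
/-- If `1 - ε ≤ ∏ zᵢ` with `0 ≤ zᵢ`, then `N * (1 - ε) ≤ ∑ zᵢ`, by the AM-GM inequality. -/
theorem card_mul_one_sub_le_sum {N : ℕ} (hN : 1 ≤ N) {ε : ℝ} (h0 : 0 ≤ ε) (h1 : ε < 1)
    (z : Fin N → ℝ) (hz : ∀ j, 0 ≤ z j) (hprod : 1 - ε ≤ ∏ j, z j) :
    (N : ℝ) * (1 - ε) ≤ ∑ j, z j := by
  have hN' : (1 : ℝ) ≤ N := by exact_mod_cast hN
  have hN0 : (0 : ℝ) < N := by linarith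
  have amgm := Real.geom_mean_le_arith_mean_weighted Finset.univ (fun _ : Fin N => (N : ℝ)⁻¹) z
    (fun _ _ => by positivity) (by simp [hN0.ne']) (fun j _ => hz j)
  rw [Real.finsetProd_rpow _ _ (fun j _ => hz j), ← Finset.mul_sum] at amgm
  have hroot : 1 - ε ≤ (∏ j, z j) ^ (N : ℝ)⁻¹ :=
    calc 1 - ε ≤ (1 - ε) ^ (N : ℝ)⁻¹ :=
          Real.self_le_rpow_of_le_one (by linarith) (by linarith) (inv_le_one_of_one_le₀ hN')
      _ ≤ _ := Real.rpow_le_rpow (by linarith) hprod (by positivity)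
  calc (N : ℝ) * (1 - ε) ≤ N * ((N : ℝ)⁻¹ * ∑ j, z j) := by gcongr; exact hroot.trans amgm
    _ = ∑ j, z j := mul_inv_cancel_left₀ hN0.ne' _

/-- On `[0, M]`, `(x - 1)²` is controlled by `(√x - 1)²`. -/
theorem sub_one_sq_le_mul_sqrt_sub_one_sq {x M : ℝ} (hx : 0 ≤ x) (hM : x ≤ M) :
    (x - 1) ^ 2 ≤ 2 * (M + 1) * (√x - 1) ^ 2 := by
  have hs := Real.sq_sqrt hx
  calc (x - 1) ^ 2 = (√x + 1) ^ 2 * (√x - 1) ^ 2 := by rw [← mul_pow]; congr 1; linarith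
    _ ≤ 2 * (M + 1) * (√x - 1) ^ 2 := by gcongr; nlinarith [sq_nonneg (√x - 1)]

/-- **Eigenvalue form of the matrix lemma.**
Let `N ≥ 1` be an integer and `ε ∈ (0,1)`. There is a constant `C` depending only on `N`
such that: if `λ₁, …, λ_N` are positive reals with `∑ λⱼ ≤ N + ε` and `∏ λⱼ ≥ 1 − ε`,
then `∑ (λⱼ − 1)² ≤ C * ε`. -/
theorem eigenvalue_trace_det_pinching (N : ℕ) (hN : 1 ≤ N) :
    ∃ C : ℝ, 0 < C ∧ ∀ (ε : ℝ), 0 < ε → ε < 1 →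
      ∀ l : Fin N → ℝ, (∀ j, 0 < l j) →
        (∑ j, l j) ≤ (N : ℝ) + ε → (1 - ε) ≤ (∏ j, l j) →
        (∑ j, (l j - 1) ^ 2) ≤ C * ε := by
  refine ⟨2 * (N + 1 + 1) * (2 * N + 1), by positivity, fun ε h0 h1 l hl hsum hprod => ?_⟩
  have hle (j : Fin N) : l j ≤ N + 1 := by
    linarith [Finset.single_le_sum (fun i _ => (hl i).le) (Finset.mem_univ j)]
  have hsqrt : 1 - ε ≤ ∏ j, √(l j) := by
    have hsq : (∏ j, √(l j)) ^ 2 = ∏ j, l j := by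
      rw [← Finset.prod_pow]
      exact Finset.prod_congr rfl fun j _ => Real.sq_sqrt (hl j).le
    exact (abs_le_of_sq_le_sq' (by nlinarith) (by positivity)).2
  have hmean := card_mul_one_sub_le_sum hN h0.le h1 _ (fun j => Real.sqrt_nonneg (l j)) hsqrt
  have hexpand : ∑ j, (√(l j) - 1) ^ 2 = ∑ j, l j - 2 * ∑ j, √(l j) + N := by
    simp [sub_sq, Real.sq_sqrt (hl _).le, Finset.sum_add_distrib, Finset.mul_sum]
  calc ∑ j, (l j - 1) ^ 2 ≤ ∑ j, 2 * ((N : ℝ) + 1 + 1) * (√(l j) - 1) ^ 2 :=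
        Finset.sum_le_sum fun j _ => sub_one_sq_le_mul_sqrt_sub_one_sq (hl j).le (hle j)
    _ = 2 * (N + 1 + 1) * ∑ j, (√(l j) - 1) ^ 2 := by rw [Finset.mul_sum]
    _ ≤ 2 * (N + 1 + 1) * ((2 * N + 1) * ε) := by gcongr; rw [hexpand]; linarith
    _ = 2 * (N + 1 + 1) * (2 * N + 1) * ε := by ring
end

section
/- Let N ≥ 2 be an integer, ε ∈ (0,1), and let λ₁, …, λ_N be positive real numbers. Define the normalized elementary symmetric means S_k = binom(N,k)^{-1} Σ_{1 ≤ i₁ < ⋯ < i_k ≤ N} λ_{i₁}⋯λ_{i_k} for k = 1, …, N. If S₁ ≤ 1 + ε/N and S_N ≥ 1 − ε, then |S₁ − 1| ≤ ε and |S₂ − 1| ≤ 3ε. -/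
open Finset

/-- The normalized elementary symmetric mean
`S_k = binom(N,k)⁻¹ * ∑_{1 ≤ i₁ < ⋯ < i_k ≤ N} λ_{i₁} ⋯ λ_{i_k}`
of the numbers `l 0, …, l (N-1)`. -/
noncomputable def esymmMean (N : ℕ) (l : Fin N → ℝ) (k : ℕ) : ℝ :=
  ((N.choose k : ℝ))⁻¹ * ∑ s ∈ Finset.univ.powersetCard k, ∏ i ∈ s, l i

theorem sum_powersetCard_sum {α M : Type*} [AddCommMonoid M] (t : Finset α)
    (f : α → M) {k : ℕ} (hk : 1 ≤ k) :
    ∑ s ∈ t.powersetCard k, ∑ i ∈ s, f i = (#t - 1).choose (k - 1) • ∑ i ∈ t, f i := by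
  classical
  rw [Finset.sum_comm' (t' := t) (s' := fun i => {s ∈ t.powersetCard k | {i} ⊆ s}), smul_sum]
  · refine sum_congr rfl fun i hi => ?_
    rw [sum_const, card_filter_powersetCard_subset _ _ _ (by simpa using hi) (by simpa using hk),
      card_singleton]
  · intro s i
    simp only [mem_powersetCard, mem_filter, singleton_subset_iff]
    exact ⟨fun h => ⟨h, h.1.1 h.2⟩, fun h => h.1⟩

theorem sum_sq_add_two_mul_sum_powersetCard_two {α R : Type*} [CommSemiring R]
    (t : Finset α) (f : α → R) :
    ∑ i ∈ t, f i ^ 2 + 2 * ∑ s ∈ t.powersetCard 2, ∏ i ∈ s, f i = (∑ i ∈ t, f i) ^ 2 := by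
  classical
  induction t using Finset.induction_on with
  | empty => simp [powersetCard_eq_empty.2 (show #(∅ : Finset α) < 2 by simp)]
  | insert a t ha ih =>
    have h : ∑ s ∈ (insert a t).powersetCard 2, ∏ i ∈ s, f i =
        ∑ s ∈ t.powersetCard 2, ∏ i ∈ s, f i + f a * ∑ i ∈ t, f i := by
      rw [powersetCard_succ_insert ha, sum_union, sum_image]
      · simp only [powersetCard_one, sum_map, mul_sum]
        congr 1
        refine sum_congr rfl fun i hi => ?_
        have hai : a ≠ i := fun h => ha (h ▸ hi)
        simp [hai]
      · intro u hu v hv huv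
        have hu' : a ∉ u := fun h => ha ((mem_powersetCard.1 hu).1 h)
        have hv' : a ∉ v := fun h => ha ((mem_powersetCard.1 hv).1 h)
        rw [← erase_insert hu', ← erase_insert hv', huv]
      · rw [disjoint_left]
        intro u hu hu'
        obtain ⟨v, -, rfl⟩ := mem_image.1 hu'
        exact ha ((mem_powersetCard.1 hu).1 (mem_insert_self a v))
    rw [h, sum_insert ha, sum_insert ha, add_sq, ← ih]
    ring

theorem esymmMean_self (N : ℕ) (l : Fin N → ℝ) : esymmMean N l N = ∏ i, l i := by
  have h : (univ : Finset (Fin N)).powersetCard N = {univ} := by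
    simpa using powersetCard_self (univ : Finset (Fin N))
  simp [esymmMean, h]

theorem esymmMean_one (N : ℕ) (l : Fin N → ℝ) : esymmMean N l 1 = (N : ℝ)⁻¹ * ∑ i, l i := by
  simp [esymmMean, powersetCard_one]

theorem esymmMean_pos {N : ℕ} {l : Fin N → ℝ} (hl : ∀ j, 0 < l j) {k : ℕ} (hkN : k ≤ N) :
    0 < esymmMean N l k := by
  have hc : (0 : ℝ) < N.choose k := by exact_mod_cast Nat.choose_pos hkN
  refine mul_pos (inv_pos.2 hc) (sum_pos (fun s _ => prod_pos fun i _ => hl i) ?_)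
  exact powersetCard_nonempty.2 (by simpa using hkN)

/-- The last of Maclaurin's inequalities, `S_N ^ (k / N) ≤ S_k`, in logarithmic form. -/
theorem div_mul_log_esymmMean_self_le {N : ℕ} {l : Fin N → ℝ} (hl : ∀ j, 0 < l j) {k : ℕ}
    (hk : 1 ≤ k) (hkN : k ≤ N) :
    (k / N : ℝ) * Real.log (esymmMean N l N) ≤ Real.log (esymmMean N l k) := by
  have hc : (0 : ℝ) < N.choose k := by exact_mod_cast Nat.choose_pos hkN
  have hN : (0 : ℝ) < N := by exact_mod_cast (by omega : 0 < N)
  have hlog (s : Finset (Fin N)) : Real.log (∏ i ∈ s, l i) = ∑ i ∈ s, Real.log (l i) :=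
    Real.log_prod fun i _ => (hl i).ne'
  have key := strictConcaveOn_log_Ioi.concaveOn.le_map_sum
    (t := (univ : Finset (Fin N)).powersetCard k) (w := fun _ => (N.choose k : ℝ)⁻¹)
    (p := fun s => ∏ i ∈ s, l i) (fun _ _ => (inv_pos.2 hc).le)
    (by simp [hc.ne']) (fun s _ => prod_pos fun i _ => hl i)
  simp only [smul_eq_mul, ← mul_sum, hlog] at key
  rw [sum_powersetCard_sum _ _ hk, ← hlog, ← esymmMean_self, card_univ, Fintype.card_fin,
    nsmul_eq_mul, ← mul_assoc] at key
  have h : (N : ℝ) * (N - 1).choose (k - 1) = N.choose k * k := by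
    obtain ⟨n, rfl⟩ : ∃ n, N = n + 1 := ⟨N - 1, by omega⟩
    obtain ⟨m, rfl⟩ : ∃ m, k = m + 1 := ⟨k - 1, by omega⟩
    exact_mod_cast Nat.add_one_mul_choose_eq n m
  have hw : (N.choose k : ℝ)⁻¹ * (N - 1).choose (k - 1) = k / N := by
    field_simp
    linarith
  rwa [hw] at key

theorem le_esymmMean_of_le_esymmMean_self {N : ℕ} {l : Fin N → ℝ} (hl : ∀ j, 0 < l j) {k : ℕ}
    (hk : 1 ≤ k) (hkN : k ≤ N) {c : ℝ} (hc0 : 0 < c) (hc1 : c ≤ 1) (hc : c ≤ esymmMean N l N) :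
    c ≤ esymmMean N l k := by
  have hN : (0 : ℝ) < N := by exact_mod_cast (by omega : 0 < N)
  have h1 : (k / N : ℝ) ≤ 1 := (div_le_one hN).2 (by exact_mod_cast hkN)
  have h0 : (0 : ℝ) ≤ k / N := by positivity
  rw [← Real.log_le_log_iff hc0 (esymmMean_pos hl hkN)]
  calc Real.log c ≤ k / N * Real.log c := by nlinarith [Real.log_nonpos hc0.le hc1]
    _ ≤ k / N * Real.log (esymmMean N l N) :=
      mul_le_mul_of_nonneg_left (Real.log_le_log hc0 hc) h0
    _ ≤ _ := div_mul_log_esymmMean_self_le hl hk hkN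

theorem esymmMean_two_le_sq (N : ℕ) (hN : 2 ≤ N) (l : Fin N → ℝ) :
    esymmMean N l 2 ≤ esymmMean N l 1 ^ 2 := by
  have hN' : (2 : ℝ) ≤ N := by exact_mod_cast hN
  have h := sum_sq_add_two_mul_sum_powersetCard_two univ l
  have hcs := sq_sum_le_card_mul_sum_sq (s := univ) (f := l)
  rw [card_univ, Fintype.card_fin] at hcs
  rw [esymmMean_one, esymmMean, Nat.cast_choose_two, mul_pow, inv_pow, inv_mul_eq_div,
    inv_mul_eq_div, div_le_div_iff₀ (by nlinarith) (by positivity)]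
  nlinarith

/-- **Symmetric-mean pinching via Maclaurin's inequalities.**
Let `N ≥ 2`, `ε ∈ (0,1)` and `λ₁, …, λ_N > 0`. If the normalized elementary symmetric
means satisfy `S₁ ≤ 1 + ε/N` and `S_N ≥ 1 − ε`, then `|S₁ − 1| ≤ ε` and `|S₂ − 1| ≤ 3ε`. -/
theorem esymmMean_pinching (N : ℕ) (hN : 2 ≤ N) (ε : ℝ) (hε0 : 0 < ε) (hε1 : ε < 1)
    (l : Fin N → ℝ) (hl : ∀ j, 0 < l j)
    (hS1 : esymmMean N l 1 ≤ 1 + ε / N) (hSN : 1 - ε ≤ esymmMean N l N) :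
    |esymmMean N l 1 - 1| ≤ ε ∧ |esymmMean N l 2 - 1| ≤ 3 * ε := by
  have hN' : (2 : ℝ) ≤ N := by exact_mod_cast hN
  have hd : ε / N ≤ ε / 2 := div_le_div_of_nonneg_left hε0.le two_pos hN'
  have hpos : 0 < esymmMean N l 1 := esymmMean_pos hl (by omega)
  have h1 : 1 - ε ≤ esymmMean N l 1 :=
    le_esymmMean_of_le_esymmMean_self hl le_rfl (by omega) (by linarith) (by linarith) hSN
  have h2 : 1 - ε ≤ esymmMean N l 2 :=
    le_esymmMean_of_le_esymmMean_self hl (by omega) hN (by linarith) (by linarith) hSN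
  have h3 := esymmMean_two_le_sq N hN l
  have h4 : esymmMean N l 1 ^ 2 ≤ (1 + ε / 2) ^ 2 :=
    pow_le_pow_left₀ hpos.le (by linarith) 2
  constructor <;> rw [abs_le] <;> constructor <;> nlinarith
end

section
/- Let C₀ ∈ ℝ and let u: [0,∞) → ℝ be a twice differentiable function satisfying the one-sided bound u''(t) ≤ C₀ for all t ≥ 0. If u(t) → 0 as t → ∞, then u'(t) → 0 as t → ∞. -/
open Filter

/-- If `f' ≤ C` on `[a, ∞)`, then `f` grows at rate at most `C` there. -/
theorem sub_le_mul_sub_of_deriv_le_Ici {f : ℝ → ℝ} {a C : ℝ}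
    (hf : ∀ t ≥ a, DifferentiableAt ℝ f t) (hC : ∀ t ≥ a, deriv f t ≤ C)
    {x y : ℝ} (hx : a ≤ x) (hxy : x ≤ y) : f y - f x ≤ C * (y - x) := by
  exact (convex_Ici a).image_sub_le_mul_sub_of_deriv_le
    (fun t ht => (hf t ht).continuousAt.continuousWithinAt)
    (fun t ht => (hf t (interior_subset ht)).differentiableWithinAt)
    (fun t ht => hC t (interior_subset ht)) x hx y (hx.trans hxy) hxy

/-- If `u'' ≤ C` on `[a, ∞)`, the difference quotient of `u` over `[x, x + h]` is at most
`u' x + C * h` and at least `u' (x + h) - C * h`. -/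
theorem slope_bounds_of_second_deriv_le {u : ℝ → ℝ} {a C : ℝ} (hC_nonneg : 0 ≤ C)
    (hu : ∀ t ≥ a, DifferentiableAt ℝ u t)
    (hu' : ∀ t ≥ a, DifferentiableAt ℝ (deriv u) t)
    (hC : ∀ t ≥ a, deriv (deriv u) t ≤ C)
    {x h : ℝ} (hx : a ≤ x) (hh : 0 < h) :
    (u (x + h) - u x) / h ≤ deriv u x + C * h ∧
      deriv u (x + h) - C * h ≤ (u (x + h) - u x) / h := by
  obtain ⟨c, ⟨hxc, hch⟩, hc⟩ := exists_deriv_eq_slope u (lt_add_of_pos_right x hh)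
    (fun t ht => (hu t (hx.trans ht.1)).continuousAt.continuousWithinAt)
    (fun t ht => (hu t (hx.trans ht.1.le)).differentiableWithinAt)
  rw [add_sub_cancel_left] at hc
  rw [← hc]
  have left := sub_le_mul_sub_of_deriv_le_Ici hu' hC hx hxc.le
  have right := sub_le_mul_sub_of_deriv_le_Ici hu' hC (hx.trans hxc.le) hch.le
  have hleft : C * (c - x) ≤ C * h := by gcongr; linarith
  have hright : C * (x + h - c) ≤ C * h := by gcongr; linarith
  constructor <;> linarith

/-- **One-sided second derivative bound and decay (core of Lemma 4.4).**
Let `u : [0,∞) → ℝ` be twice differentiable with `u''(t) ≤ C₀` for all `t ≥ 0`.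
If `u(t) → 0` as `t → ∞`, then `u'(t) → 0` as `t → ∞`. -/
theorem deriv_tendsto_zero_of_tendsto_zero_of_second_deriv_le
    (C₀ : ℝ) (u : ℝ → ℝ)
    (hu : ∀ t ≥ (0 : ℝ), DifferentiableAt ℝ u t)
    (hu' : ∀ t ≥ (0 : ℝ), DifferentiableAt ℝ (deriv u) t)
    (hu'' : ∀ t ≥ (0 : ℝ), deriv (deriv u) t ≤ C₀)
    (hlim : Tendsto u atTop (nhds 0)) :
    Tendsto (deriv u) atTop (nhds 0) := by
  set C := max C₀ 1
  have hC : 0 < C := lt_max_of_lt_right one_pos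
  have hbound : ∀ t ≥ (0 : ℝ), deriv (deriv u) t ≤ C := fun t ht =>
    (hu'' t ht).trans (le_max_left _ _)
  rw [Metric.tendsto_nhds]
  intro ε hε
  set h := ε / (2 * C)
  have hh : 0 < h := by positivity
  have hCh : C * h = ε / 2 := by simp only [h]; field_simp
  have forward : Tendsto (fun t => (u (t + h) - u t) / h) atTop (nhds 0) := by
    simpa using ((hlim.comp (tendsto_atTop_add_const_right atTop h tendsto_id)).sub
      hlim).div_const h
  have backward : Tendsto (fun t => (u (t - h + h) - u (t - h)) / h) atTop (nhds 0) :=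
    forward.comp (tendsto_atTop_add_const_right atTop (-h) tendsto_id)
  filter_upwards [forward.eventually (lt_mem_nhds (neg_lt_zero.mpr (half_pos hε))),
    backward.eventually (gt_mem_nhds (half_pos hε)), eventually_ge_atTop h]
    with t hfwd hbwd hht
  have lower := (slope_bounds_of_second_deriv_le hC.le hu hu' hbound (hh.le.trans hht) hh).1
  have upper :=
    (slope_bounds_of_second_deriv_le hC.le hu hu' hbound (sub_nonneg.mpr hht) hh).2
  rw [sub_add_cancel] at upper hbwd
  rw [Real.dist_eq, sub_zero, abs_lt]
  constructor <;> linarith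
end
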